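/- arXiv:2103.08936 — 2 statements merged into one kernel-verified Lean document; each statement's English description precedes it below -/
import Mathlib

section
/- Let U be a finite set of n servers, let B ⊆ U with |B| ≤ f be the Byzantine servers, and let Bcast be a relation between servers and records such that every correct server broadcasts at most one record for the given index: for all i ∈ U \ B and records r, r', if Bcast(i, r) and Bcast(i, r') then r = r'. Suppose there exist C, C' ⊆ U with |C| ≥ ⌊n/2⌋ + f + 1 and |C'| ≥ ⌊n/2⌋ + f + 1 such that Bcast(i, r) for all i ∈ C and Bcast(i, r') for all i ∈ C'. Then r = r'. (Hence at most one record per index can be accepted by the servers of the single-writer BDLO, which yields the Byzantine Strong Prefix property.) -/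
/-- If every correct server broadcasts at most one record for a given index,
and each of the records `r` and `r'` was broadcast by a quorum of at least
`⌊n/2⌋ + f + 1` servers out of the `n` servers of `U` (of which at most `f`,
those in `B`, are Byzantine), then `r = r'`. -/
theorem at_most_one_record_per_index
    {ι ρ : Type*} [DecidableEq ι] (n f : ℕ) (U B : Finset ι)
    (hU : U.card = n) (hBsub : B ⊆ U) (hB : B.card ≤ f)
    (Bcast : ι → ρ → Prop)
    (hcorrect : ∀ i ∈ U, i ∉ B → ∀ r r' : ρ, Bcast i r → Bcast i r' → r = r')
    (r r' : ρ)
    (h : ∃ C C' : Finset ι, C ⊆ U ∧ C' ⊆ U ∧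
          C.card ≥ n / 2 + f + 1 ∧ C'.card ≥ n / 2 + f + 1 ∧
          (∀ i ∈ C, Bcast i r) ∧ (∀ i ∈ C', Bcast i r')) :
    r = r' := by
  obtain ⟨C, C', hC, hC', hcard, hcard', hr, hr'⟩ := h
  have hunion : (C ∪ C').card ≤ n := hU ▸ Finset.card_le_card (Finset.union_subset hC hC')
  have hinter := Finset.card_union_add_card_inter C C'
  obtain ⟨i, hi, hiB⟩ : ∃ i ∈ C ∩ C', i ∉ B :=
    Finset.exists_mem_notMem_of_card_lt_card (by omega)
  obtain ⟨hiC, hiC'⟩ := Finset.mem_inter.mp hi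
  exact hcorrect i (hC hiC) hiB r r' (hr i hiC) (hr' i hiC')
end

section
/- For each time t let A(t) be a set of indexed records (pairs (k, ρ) of a positive index and a data value), and let S(t) = { r ∈ A(t) : r has index 1, or there exists r' ∈ A(t) whose index is one less than the index of r }. Fix m ≥ 1 and data values ρ_1, …, ρ_m, and suppose that for every k with 1 ≤ k ≤ m there exists a time t_k such that (k, ρ_k) ∈ A(t) for all t ≥ t_k. Then there exists a time t* such that for all t ≥ t* and all k with 1 ≤ k ≤ m, the record (k, ρ_k) belongs to S(t). In particular, eventually every GET operation of the single-writer BDLO permanently returns a sequence containing ρ_m. -/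
/-- If for every index `k` with `1 ≤ k ≤ m` the record `(k, ρ k)` is eventually
permanently in `A t`, then eventually all these records permanently pass the
filter `S t` (a record passes if its index is `1` or some record of `A t` has
the preceding index). -/
theorem eventually_records_pass_filter
    {δ : Type*} (A : ℕ → Set (ℕ × δ)) (m : ℕ) (hm : m ≥ 1) (ρ : ℕ → δ)
    (S : ℕ → Set (ℕ × δ))
    (hS : ∀ t, S t = {r ∈ A t | r.1 = 1 ∨ ∃ r' ∈ A t, r'.1 + 1 = r.1})
    (hev : ∀ k, 1 ≤ k → k ≤ m → ∃ tk : ℕ, ∀ t ≥ tk, (k, ρ k) ∈ A t) :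
    ∃ tstar : ℕ, ∀ t ≥ tstar, ∀ k, 1 ≤ k → k ≤ m → (k, ρ k) ∈ S t := by
  choose! T hT using hev
  refine ⟨(Finset.Icc 1 m).sup T, fun t ht k hk hkm => ?_⟩
  have mem : ∀ j, 1 ≤ j → j ≤ m → (j, ρ j) ∈ A t := fun j hj hjm =>
    hT j hj hjm t ((Finset.le_sup (Finset.mem_Icc.2 ⟨hj, hjm⟩)).trans ht)
  rw [hS]
  refine ⟨mem k hk hkm, ?_⟩
  rcases hk.eq_or_lt with rfl | hk1
  · exact Or.inl rfl
  · exact Or.inr ⟨_, mem (k - 1) (by omega) (by omega), Nat.sub_add_cancel hk⟩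
end
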